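/- Let p be an odd prime, n = rk, and ℓ a positive integer such that r/gcd(r, 2ℓ) is even. Let f(x) = T^n_k(x^{p^i + p^{i+ℓk}}) with 0 ≤ i ≤ k − 1, and let γ ∈ F_{p^n}^* satisfy γ^{p^{2kℓ} − 1} = −1 and T^n_k(γ^{1 + p^{ℓk}}) = 0. Then for any F_{p^k}-linear permutation L of F_{p^n} and any h : F_{p^k} → F_{p^k}, the map x ↦ L(x) + L(γ)·h(T^n_k(x^{p^i + p^{i+ℓk}})) is a permutation of F_{p^n}. Moreover, F(x) = x + γ·h(T^n_k(x^{p^i + p^{i+ℓk}})) has compositional inverse F^{−1}(x) = x + (p−1)·γ·h(T^n_k(x^{p^i + p^{i+ℓk}})). -/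

import Mathlib

/-- The relative trace map from `F_{p^n}` to the subfield `F_{p^k}`, where `n = r·k`:
`T^n_k(x) = x + x^{p^k} + ⋯ + x^{p^{(r-1)k}}`. -/
def traceMap (p k r : ℕ) {F : Type*} [Field F] (x : F) : F :=
  ∑ t ∈ Finset.range r, x ^ p ^ (k * t)

theorem aux_tm_add (p k r : ℕ) {F : Type*} [Field F] [Fact p.Prime] [CharP F p] (x y : F) :
    traceMap p k r (x + y) = traceMap p k r x + traceMap p k r y := by
  simp only [traceMap, add_pow_char_pow, Finset.sum_add_distrib]

theorem aux_fix {M : Type*} [Monoid M] (p k : ℕ) (c : M) (hc : c ^ p ^ k = c) (t : ℕ) :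
    c ^ p ^ (k * t) = c := by
  induction t with
  | zero => simp
  | succ t ih => rw [Nat.mul_succ, pow_add, pow_mul, ih, hc]

theorem aux_tm_smul (p k r : ℕ) {F : Type*} [Field F] (c y : F) (hc : c ^ p ^ k = c) :
    traceMap p k r (c * y) = c * traceMap p k r y := by
  simp only [traceMap, mul_pow, aux_fix p k c hc, Finset.mul_sum]

theorem aux_tm_pow (p k r i : ℕ) {F : Type*} [Field F] [Fact p.Prime] [CharP F p] (y : F) :
    traceMap p k r (y ^ p ^ i) = traceMap p k r y ^ p ^ i := by
  simp only [traceMap, sum_pow_char_pow]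
  refine Finset.sum_congr rfl fun t _ => ?_
  rw [← pow_mul, ← pow_mul, mul_comm]

theorem aux_tm_frob (p k r : ℕ) {F : Type*} [Field F] (y : F) (hy : y ^ p ^ (k * r) = y) :
    traceMap p k r (y ^ p ^ k) = traceMap p k r y := by
  have h1 : traceMap p k r (y ^ p ^ k) = ∑ t ∈ Finset.range r, y ^ p ^ (k * (t + 1)) := by
    refine Finset.sum_congr rfl fun t _ => ?_
    rw [← pow_mul, ← pow_add, Nat.mul_succ, add_comm]
  have h2 := Finset.sum_range_succ (fun t => y ^ p ^ (k * t)) r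
  rw [Finset.sum_range_succ'] at h2
  simp only [hy, mul_zero, pow_zero, pow_one] at h2
  rw [h1]
  exact add_right_cancel h2

/-- **Corollary 4.6.** Let `p` be an odd prime, `n = rk`, and `ℓ > 0` with
`r / gcd(r, 2ℓ)` even.  Let `f(x) = T^n_k(x^{p^i+p^{i+ℓk}})` with `0 ≤ i ≤ k − 1`,
and let `γ ∈ F_{p^n}^*` satisfy `γ^{p^{2kℓ}−1} = −1` and `T^n_k(γ^{1+p^{ℓk}}) = 0`.
Then for any `F_{p^k}`-linear permutation `L` of `F_{p^n}` and any
`h : F_{p^k} → F_{p^k}`, the map `x ↦ L(x) + L(γ)·h(f(x))` is a permutation of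
`F_{p^n}`; moreover `F(x) = x + γ·h(f(x))` has compositional inverse
`F^{−1}(x) = x + (p−1)·γ·h(f(x))`. -/
theorem stmt_13 {p k r n ℓ i : ℕ} (hp : p.Prime) (hp2 : p ≠ 2) (hk : 0 < k)
    (hr : 0 < r) (hn : n = r * k) (hℓ : 0 < ℓ)
    (heven : Even (r / Nat.gcd r (2 * ℓ))) (hik : i ≤ k - 1)
    {F : Type*} [Field F] [Fintype F] (hcard : Fintype.card F = p ^ n)
    (γ : F) (hγ : γ ≠ 0) (hγ1 : γ ^ (p ^ (2 * k * ℓ) - 1) = -1)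
    (hγ2 : traceMap p k r (γ ^ (1 + p ^ (ℓ * k))) = 0)
    (h : F → F) (hh : ∀ u : F, u ^ p ^ k = u → h u ^ p ^ k = h u)
    (L : F → F) (lam : Fin r → F)
    (hL : ∀ x, L x = ∑ t : Fin r, lam t * x ^ p ^ (k * (t : ℕ)))
    (hLbij : Function.Bijective L) :
    Function.Bijective (fun x : F =>
      L x + L γ * h (traceMap p k r (x ^ (p ^ i + p ^ (i + ℓ * k))))) ∧
    Function.LeftInverse
      (fun x : F => x + ((p - 1 : ℕ) : F) * γ *
        h (traceMap p k r (x ^ (p ^ i + p ^ (i + ℓ * k)))))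
      (fun x : F => x + γ * h (traceMap p k r (x ^ (p ^ i + p ^ (i + ℓ * k))))) ∧
    Function.RightInverse
      (fun x : F => x + ((p - 1 : ℕ) : F) * γ *
        h (traceMap p k r (x ^ (p ^ i + p ^ (i + ℓ * k)))))
      (fun x : F => x + γ * h (traceMap p k r (x ^ (p ^ i + p ^ (i + ℓ * k))))) := by
  haveI : Fact p.Prime := ⟨hp⟩
  haveI : CharP F p := charP_of_card_eq_prime_pow hcard
  have hfr : ∀ y : F, y ^ p ^ (k * r) = y := fun y => by
    have := FiniteField.pow_card y
    rwa [hcard, hn, mul_comm] at this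
  have hT1 : ∀ y : F, traceMap p k r y ^ p ^ k = traceMap p k r y := fun y => by
    rw [← aux_tm_pow, aux_tm_frob p k r y (hfr y)]
  have hTl : ∀ y : F, traceMap p k r (y ^ p ^ (ℓ * k)) = traceMap p k r y := fun y => by
    rw [aux_tm_pow, mul_comm, aux_fix p k _ (hT1 y)]
  have hγ3 : (γ ^ p ^ (ℓ * k)) ^ p ^ (ℓ * k) = -γ := by
    rw [← pow_mul, ← pow_add]
    have e : p ^ (ℓ * k + ℓ * k) = (p ^ (2 * k * ℓ) - 1) + 1 := by
      rw [Nat.sub_add_cancel (Nat.one_le_pow _ _ hp.pos)]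
      congr 1; ring
    rw [e, pow_succ, hγ1]; ring
  have hneg : ∀ y : F, traceMap p k r (-y) = - traceMap p k r y := fun y => by
    have h0 : traceMap p k r (0 : F) = 0 := by
      have := aux_tm_add p k r (0 : F) 0
      rw [add_zero] at this
      exact left_eq_add.mp this
    have := aux_tm_add p k r y (-y)
    rw [add_neg_cancel, h0] at this
    exact (neg_eq_of_add_eq_zero_right this.symm).symm
  have hf : ∀ x : F, traceMap p k r (x ^ (p ^ i + p ^ (i + ℓ * k)))
      = traceMap p k r (x * x ^ p ^ (ℓ * k)) ^ p ^ i := fun x => by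
    rw [← aux_tm_pow]; congr 1
    rw [pow_add x, mul_pow, ← pow_mul, pow_add p, mul_comm (p ^ i)]
  have hinv : ∀ x c : F, c ^ p ^ k = c → traceMap p k r ((x + γ * c) ^ (p ^ i + p ^ (i + ℓ * k)))
      = traceMap p k r (x ^ (p ^ i + p ^ (i + ℓ * k))) := fun x c hc => by
    rw [hf, hf]; congr 1
    have hcl : c ^ p ^ (ℓ * k) = c := by rw [mul_comm]; exact aux_fix p k c hc ℓ
    have e : (x + γ * c) * (x + γ * c) ^ p ^ (ℓ * k) = x * x ^ p ^ (ℓ * k)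
        + (c * (x * γ ^ p ^ (ℓ * k)) + (c * (x ^ p ^ (ℓ * k) * γ)
        + c * (c * γ ^ (1 + p ^ (ℓ * k))))) := by
      rw [add_pow_char_pow, mul_pow, hcl, pow_add γ]; ring
    have hcross : traceMap p k r (x * γ ^ p ^ (ℓ * k))
        = - traceMap p k r (x ^ p ^ (ℓ * k) * γ) := by
      rw [← hTl, mul_pow, hγ3, mul_neg, hneg]
    rw [e]
    simp only [aux_tm_add, aux_tm_smul p k r c _ hc, hγ2, hcross]
    ring
  have hfix : ∀ x : F, (h (traceMap p k r (x ^ (p ^ i + p ^ (i + ℓ * k))))) ^ p ^ k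
      = h (traceMap p k r (x ^ (p ^ i + p ^ (i + ℓ * k)))) := fun x => hh _ (hT1 _)
  have hnegfix : ∀ c : F, c ^ p ^ k = c → (-c) ^ p ^ k = -c := fun c hc => by
    rw [(hp.odd_of_ne_two hp2).pow.neg_pow, hc]
  have hp1 : ((p - 1 : ℕ) : F) = -1 := by
    rw [Nat.cast_sub hp.one_le, CharP.cast_eq_zero]; simp
  have hleft : Function.LeftInverse
      (fun x : F => x + ((p - 1 : ℕ) : F) * γ *
        h (traceMap p k r (x ^ (p ^ i + p ^ (i + ℓ * k)))))
      (fun x : F => x + γ * h (traceMap p k r (x ^ (p ^ i + p ^ (i + ℓ * k))))) := by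
    intro x
    simp only [hp1]
    rw [hinv x _ (hfix x)]; ring
  have hright : Function.RightInverse
      (fun x : F => x + ((p - 1 : ℕ) : F) * γ *
        h (traceMap p k r (x ^ (p ^ i + p ^ (i + ℓ * k)))))
      (fun x : F => x + γ * h (traceMap p k r (x ^ (p ^ i + p ^ (i + ℓ * k))))) := by
    intro x
    simp only [hp1]
    have e : ∀ c : F, x + -1 * γ * c = x + γ * (-c) := fun c => by ring
    rw [e, hinv x _ (hnegfix _ (hfix x))]; ring
  refine ⟨?_, hleft, hright⟩
  have hcomp := hLbij.comp (⟨hleft.injective, hright.surjective⟩ : Function.Bijective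
    (fun x : F => x + γ * h (traceMap p k r (x ^ (p ^ i + p ^ (i + ℓ * k))))))
  convert hcomp using 1
  funext x
  simp only [Function.comp, hL, Finset.sum_mul, ← Finset.sum_add_distrib]
  refine Finset.sum_congr rfl fun t _ => ?_
  rw [add_pow_char_pow, mul_pow γ, aux_fix p k _ (hfix x)]; ring
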